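/- Let $\{X_i,\mathscr{F}_i\}$ be a martingale difference sequence of $C(\mathcal{S})$ satisfying (A4) and (A5), and suppose: (A6') there is a nonnegative random sequence $\{\varsigma_i\}$ with $\lim_n\frac{1}{n}\sum_i E[\varsigma_i^2]=0$ and $|X_i(s_1)-X_i(s_2)|\le\varsigma_i\rho(s_1,s_2)$ a.s.; (A7) $E[\varsigma_i^2\mid\mathscr{F}_{i-1}]\le\bar{b}$ a.s. for a constant $\bar{b}>0$. Then there exists a Gaussian measure $\mu$ on $C(\mathcal{S})$ such that $\frac{1}{\sqrt{n}}\sum_{i=1}^n X_i\xrightarrow{\mathcal{D}}\mu$. -/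

import Mathlib

open MeasureTheory Filter

/-- The covering number of `S` by `ρ`-balls of radius `r`. -/
noncomputable def coveringNumber {S : Type*} (ρ : S → S → ℝ) (r : ℝ) : ℕ∞ :=
  ⨅ (t : Finset S) (_ : ∀ s : S, ∃ c ∈ t, ρ s c ≤ r), (t.card : ℕ∞)

/-- The metric entropy `H(S, ρ, r)` of `S` with respect to `ρ` at radius `r`. -/
noncomputable def metricEntropy {S : Type*} (ρ : S → S → ℝ) (r : ℝ) : ℝ :=
  Real.log ((coveringNumber ρ r).toNat)

/-- A Gaussian measure on a Banach space: every continuous linear functional pushes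
it forward to a Gaussian distribution on `ℝ`. -/
def IsGaussianMeasure {B : Type*} [NormedAddCommGroup B] [NormedSpace ℝ B]
    [MeasurableSpace B] (γ : Measure B) : Prop :=
  ∀ L : B →L[ℝ] ℝ, ∃ (m : ℝ) (v : NNReal), γ.map L = ProbabilityTheory.gaussianReal m v

/-- Pull-out property under the integral sign: a bounded factor measurable with respect to `m` does
not distinguish an integrable function from its conditional expectation. -/
theorem integral_condExp_smul_of_bound {Ω : Type*} {m m0 : MeasurableSpace Ω} {μ : Measure Ω}
    [IsFiniteMeasure μ] (hm : m ≤ m0) {F : Type*} [NormedAddCommGroup F] [NormedSpace ℝ F]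
    [CompleteSpace F] {G : Ω → F} (hG : StronglyMeasurable[m] G) {g : Ω → ℝ}
    (hg : Integrable g μ) (C : ℝ) (hC : ∀ᵐ ω ∂μ, ‖G ω‖ ≤ C) :
    ∫ ω, (μ[g|m]) ω • G ω ∂μ = ∫ ω, g ω • G ω ∂μ := by
  have h := condExp_stronglyMeasurable_bilin_of_bound
    (B := (ContinuousLinearMap.lsmul ℝ ℝ : ℝ →L[ℝ] F →L[ℝ] F).flip) hm hG hg C hC
  rw [← integral_condExp hm (f := fun ω => g ω • G ω)]
  refine integral_congr_ae ?_
  filter_upwards [h] with ω hω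
  simpa using hω.symm

theorem integrable_smul_of_bound {Ω : Type*} {m0 : MeasurableSpace Ω} {μ : Measure Ω}
    {F : Type*} [NormedAddCommGroup F] [NormedSpace ℝ F]
    {G : Ω → F} (hG : AEStronglyMeasurable G μ) {g : Ω → ℝ}
    (hg : Integrable g μ) (C : ℝ) (hC : ∀ᵐ ω ∂μ, ‖G ω‖ ≤ C) :
    Integrable (fun ω => g ω • G ω) μ :=
  hg.smul_bdd C hG hC

/-- Second-order expansion of `exp (iτx + τ²v/2)` for bounded `x` and `v`. -/
theorem norm_cexp_sub_expansion_le {k τ x v : ℝ} (hτ : |τ| ≤ 1) (hx : |x| ≤ k)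
    (hv0 : 0 ≤ v) (hv : v ≤ k ^ 2) :
    ‖Complex.exp ((τ * x : ℝ) * Complex.I + (τ ^ 2 * v / 2 : ℝ)) - 1
        - (τ * x : ℝ) * Complex.I - (τ ^ 2 / 2 * (v - x ^ 2) : ℝ)‖
      ≤ ((k + k ^ 2 / 2) ^ 3 * Real.exp (k + k ^ 2 / 2) + k ^ 3 / 2 + k ^ 4 / 8) * |τ| ^ 3 := by
  have hk : 0 ≤ k := (abs_nonneg _).trans hx
  set z : ℂ := (τ * x : ℝ) * Complex.I + (τ ^ 2 * v / 2 : ℝ) with hz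
  have hz1 : ‖z‖ ≤ |τ| * (k + k ^ 2 / 2) := by
    calc ‖z‖ ≤ ‖((τ * x : ℝ) : ℂ) * Complex.I‖ + ‖((τ ^ 2 * v / 2 : ℝ) : ℂ)‖ := norm_add_le _ _
      _ = |τ| * |x| + |τ| ^ 2 * v / 2 := by
        rw [norm_mul, Complex.norm_I, mul_one, Complex.norm_real, Complex.norm_real,
          Real.norm_eq_abs, Real.norm_eq_abs, abs_mul, abs_of_nonneg (a := τ ^ 2 * v / 2)
          (by positivity), sq_abs]
      _ ≤ |τ| * k + |τ| * k ^ 2 / 2 := by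
        have : |τ| ^ 2 ≤ |τ| := by nlinarith [abs_nonneg τ]
        gcongr
      _ = _ := by ring
  have hz2 : ‖z‖ ≤ k + k ^ 2 / 2 := hz1.trans (mul_le_of_le_one_left (by positivity) hτ)
  have h3 := Complex.norm_exp_sub_sum_le_norm_mul_exp z 3
  have hdec : Complex.exp z - 1 - (τ * x : ℝ) * Complex.I - (τ ^ 2 / 2 * (v - x ^ 2) : ℝ)
      = (Complex.exp z - ∑ m ∈ Finset.range 3, z ^ m / m.factorial)
        + ((τ ^ 3 * (x * v) / 2 : ℝ) * Complex.I + (τ ^ 4 * v ^ 2 / 8 : ℝ)) := by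
    simp only [Finset.sum_range_succ, Finset.sum_range_zero, hz]
    push_cast
    simp only [Nat.factorial]
    push_cast
    ring_nf
    simp only [Complex.I_sq]
    ring
  rw [hdec]
  have hτ4 : τ ^ 4 ≤ |τ| ^ 3 := by
    have : τ ^ 4 = |τ| ^ 4 := by rw [← abs_pow, abs_of_nonneg (by positivity)]
    rw [this]
    exact pow_le_pow_of_le_one (abs_nonneg _) hτ (by norm_num)
  calc _ ≤ ‖Complex.exp z - ∑ m ∈ Finset.range 3, z ^ m / m.factorial‖
        + (‖((τ ^ 3 * (x * v) / 2 : ℝ) : ℂ) * Complex.I‖ + ‖((τ ^ 4 * v ^ 2 / 8 : ℝ) : ℂ)‖) :=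
        (norm_add_le _ _).trans (by gcongr; exact norm_add_le _ _)
    _ ≤ (|τ| * (k + k ^ 2 / 2)) ^ 3 * Real.exp (k + k ^ 2 / 2)
        + (|τ| ^ 3 * (k * k ^ 2) / 2 + |τ| ^ 3 * (k ^ 2) ^ 2 / 8) := by
        refine add_le_add (h3.trans (by gcongr)) (add_le_add ?_ ?_)
        · rw [norm_mul, Complex.norm_I, mul_one, Complex.norm_real, Real.norm_eq_abs, abs_div,
            abs_mul, abs_mul, abs_pow, abs_of_nonneg hv0, abs_two]
          gcongr
        · rw [Complex.norm_real, Real.norm_eq_abs, abs_of_nonneg (by positivity)]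
          gcongr
    _ = _ := by ring

theorem condExp_sq_bounds {Ω : Type*} {m m0 : MeasurableSpace Ω} {μ : Measure Ω}
    [IsProbabilityMeasure μ] (hm : m ≤ m0) {x : Ω → ℝ} {k : ℝ}
    (hxm : AEStronglyMeasurable x μ) (hx : ∀ᵐ ω ∂μ, |x ω| ≤ k) :
    ∀ᵐ ω ∂μ, 0 ≤ (μ[fun ω => x ω ^ 2|m]) ω ∧ (μ[fun ω => x ω ^ 2|m]) ω ≤ k ^ 2 := by
  have hle : ∀ᵐ ω ∂μ, x ω ^ 2 ≤ k ^ 2 := by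
    filter_upwards [hx] with ω h
    exact sq_le_sq.2 (h.trans (le_abs_self k))
  have hint : Integrable (fun ω => x ω ^ 2) μ :=
    Integrable.of_bound (hxm.pow 2) (k ^ 2) (by
      filter_upwards [hle] with ω h
      rwa [Real.norm_eq_abs, abs_of_nonneg (sq_nonneg _)])
  have h1 : 0 ≤ᵐ[μ] μ[fun ω => x ω ^ 2|m] := condExp_nonneg (ae_of_all _ fun ω => sq_nonneg _)
  have h2 := condExp_mono (m := m) hint (integrable_const (k ^ 2)) hle
  rw [condExp_const hm] at h2
  filter_upwards [h1, h2] with ω a b using ⟨a, b⟩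

/-- For a bounded martingale difference sequence, `exp (iτ ∑ x + τ²/2 ∑ E[x² | ·])` is almost a
martingale. -/
theorem norm_integral_cexp_compensated_sub_one_le {Ω : Type*} {m0 : MeasurableSpace Ω}
    {μ : Measure Ω} [IsProbabilityMeasure μ] (ℱ : Filtration ℕ m0) {x : ℕ → Ω → ℝ}
    (hxm : ∀ i, StronglyMeasurable[ℱ (i + 1)] (x i)) {k : ℝ}
    (hx : ∀ i, ∀ᵐ ω ∂μ, |x i ω| ≤ k) (hmd : ∀ i, μ[x i|ℱ i] =ᵐ[μ] 0) {τ : ℝ} (hτ : |τ| ≤ 1)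
    (n : ℕ) :
    ‖∫ ω, Complex.exp (∑ i ∈ Finset.range n, ((τ * x i ω : ℝ) * Complex.I
        + (τ ^ 2 * (μ[fun ω => x i ω ^ 2|ℱ i]) ω / 2 : ℝ))) ∂μ - 1‖
      ≤ n * (Real.exp (τ ^ 2 * n * k ^ 2 / 2) *
        (((k + k ^ 2 / 2) ^ 3 * Real.exp (k + k ^ 2 / 2) + k ^ 3 / 2 + k ^ 4 / 8) * |τ| ^ 3)) := by
  set v : ℕ → Ω → ℝ := fun i => μ[fun ω => x i ω ^ 2|ℱ i] with hv
  set K : ℝ := ((k + k ^ 2 / 2) ^ 3 * Real.exp (k + k ^ 2 / 2) + k ^ 3 / 2 + k ^ 4 / 8) * |τ| ^ 3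
    with hK
  have hxm' : ∀ i, StronglyMeasurable (x i) := fun i => (hxm i).mono (ℱ.le _)
  have hk : 0 ≤ k := by
    obtain ⟨ω, h⟩ := (hx 0).exists
    exact (abs_nonneg _).trans h
  have hK0 : 0 ≤ K := by positivity
  have hvb : ∀ᵐ ω ∂μ, ∀ i, 0 ≤ v i ω ∧ v i ω ≤ k ^ 2 :=
    ae_all_iff.2 fun i => condExp_sq_bounds (ℱ.le i) (hxm' i).aestronglyMeasurable (hx i)
  have hxb : ∀ᵐ ω ∂μ, ∀ i, |x i ω| ≤ k := ae_all_iff.2 hx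
  set w : ℕ → Ω → ℂ := fun i ω => (τ * x i ω : ℝ) * Complex.I + (τ ^ 2 * v i ω / 2 : ℝ) with hw
  set A : ℕ → Ω → ℂ := fun j ω => Complex.exp (∑ i ∈ Finset.range j, w i ω) with hA
  have hwm : ∀ i, StronglyMeasurable[ℱ (i + 1)] (w i) := by
    intro i
    have h1 : StronglyMeasurable[ℱ (i + 1)] (v i) :=
      stronglyMeasurable_condExp.mono (ℱ.mono (Nat.le_succ i))
    have h2 : StronglyMeasurable[ℱ (i + 1)] (fun ω => τ ^ 2 * v i ω / 2) := by
      simpa only [div_eq_mul_inv] using (h1.const_mul (τ ^ 2)).mul_const 2⁻¹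
    exact ((Complex.continuous_ofReal.comp_stronglyMeasurable
      (((hxm i).const_mul τ))).mul_const Complex.I).add
      (Complex.continuous_ofReal.comp_stronglyMeasurable h2)
  have hAm : ∀ j, StronglyMeasurable[ℱ j] (A j) := by
    intro j
    refine Complex.continuous_exp.comp_stronglyMeasurable ?_
    exact Finset.stronglyMeasurable_fun_sum _ fun i hi =>
      (hwm i).mono (ℱ.mono (Finset.mem_range.1 hi))
  have hAb : ∀ j ≤ n, ∀ᵐ ω ∂μ, ‖A j ω‖ ≤ Real.exp (τ ^ 2 * n * k ^ 2 / 2) := by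
    intro j hj
    filter_upwards [hvb] with ω h
    rw [hA, Complex.norm_exp, Real.exp_le_exp, Complex.re_sum]
    calc ∑ i ∈ Finset.range j, (w i ω).re ≤ ∑ i ∈ Finset.range j, τ ^ 2 * k ^ 2 / 2 := by
          refine Finset.sum_le_sum fun i _ => ?_
          simp only [hw, Complex.add_re, Complex.mul_re, Complex.ofReal_re, Complex.I_re,
            Complex.ofReal_im, Complex.I_im]
          have := (h i).2
          have : τ ^ 2 * v i ω ≤ τ ^ 2 * k ^ 2 := by gcongr
          linarith
      _ = j * (τ ^ 2 * k ^ 2 / 2) := by simp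
      _ ≤ n * (τ ^ 2 * k ^ 2 / 2) := by gcongr
      _ = _ := by ring
  have hAi : ∀ j ≤ n, Integrable (A j) μ := fun j hj =>
    Integrable.of_bound ((hAm j).mono (ℱ.le j)).aestronglyMeasurable _ (hAb j hj)
  have hstep : ∀ j, j + 1 ≤ n → ‖∫ ω, A (j + 1) ω ∂μ - ∫ ω, A j ω ∂μ‖
      ≤ Real.exp (τ ^ 2 * n * k ^ 2 / 2) * K := by
    intro j hj
    have hj' : j ≤ n := by omega
    have hxi : Integrable (x j) μ :=
      Integrable.of_bound (hxm' j).aestronglyMeasurable k (hx j)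
    have hx2i : Integrable (fun ω => x j ω ^ 2) μ := by
      refine Integrable.of_bound ((hxm' j).pow 2).aestronglyMeasurable (k ^ 2) ?_
      filter_upwards [hx j] with ω h
      rw [norm_pow]
      exact pow_le_pow_left₀ (norm_nonneg _) h 2
    have hAj := ((hAm j).mono (ℱ.le j)).aestronglyMeasurable (μ := μ)
    have e1 : ∫ ω, x j ω • A j ω ∂μ = 0 := by
      rw [← integral_condExp_smul_of_bound (ℱ.le j) (hAm j) hxi _ (hAb j hj')]
      rw [integral_eq_zero_of_ae]
      filter_upwards [hmd j] with ω h
      simp [h]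
    have e2 : ∫ ω, v j ω • A j ω ∂μ = ∫ ω, x j ω ^ 2 • A j ω ∂μ :=
      integral_condExp_smul_of_bound (ℱ.le j) (hAm j) hx2i _ (hAb j hj')
    have i1 := integrable_smul_of_bound hAj hxi _ (hAb j hj')
    have i2 := integrable_smul_of_bound hAj hx2i _ (hAb j hj')
    have i3 : Integrable (fun ω => v j ω • A j ω) μ :=
      integrable_smul_of_bound hAj integrable_condExp _ (hAb j hj')
    have e3 : ∫ ω, A (j + 1) ω ∂μ - ∫ ω, A j ω ∂μ
        = ∫ ω, (A (j + 1) ω - A j ω - ((τ : ℂ) * Complex.I) * (x j ω • A j ω)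
          - ((τ ^ 2 / 2 : ℝ) : ℂ) * (v j ω • A j ω - x j ω ^ 2 • A j ω)) ∂μ := by
      rw [integral_sub, integral_sub, integral_sub, integral_const_mul, integral_const_mul,
        integral_sub i3 i2, e1, e2]
      · simp
      · exact hAi _ hj
      · exact hAi _ hj'
      · exact (hAi _ hj).sub (hAi _ hj')
      · exact i1.const_mul _
      · exact ((hAi _ hj).sub (hAi _ hj')).sub (i1.const_mul _)
      · exact (i3.sub i2).const_mul _
    rw [e3]
    refine (norm_integral_le_of_norm_le_const (C := Real.exp (τ ^ 2 * n * k ^ 2 / 2) * K)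
      ?_).trans (by simp)
    filter_upwards [hvb, hxb, hAb j hj'] with ω hvω hxω hAω
    have : A (j + 1) ω - A j ω - ((τ : ℂ) * Complex.I) * (x j ω • A j ω)
          - ((τ ^ 2 / 2 : ℝ) : ℂ) * (v j ω • A j ω - x j ω ^ 2 • A j ω)
        = A j ω * (Complex.exp (w j ω) - 1 - (τ * x j ω : ℝ) * Complex.I
          - (τ ^ 2 / 2 * (v j ω - x j ω ^ 2) : ℝ)) := by
      have : A (j + 1) ω = A j ω * Complex.exp (w j ω) := by
        simp only [hA, Finset.sum_range_succ, Complex.exp_add]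
      rw [this]
      simp only [Complex.real_smul]
      push_cast
      ring
    rw [this, norm_mul]
    exact mul_le_mul hAω (norm_cexp_sub_expansion_le hτ (hxω j) (hvω j).1 (hvω j).2)
      (norm_nonneg _) (Real.exp_pos _).le
  have hind : ∀ j ≤ n, ‖∫ ω, A j ω ∂μ - 1‖ ≤ j * (Real.exp (τ ^ 2 * n * k ^ 2 / 2) * K) := by
    intro j
    induction j with
    | zero => intro _; simp [hA]
    | succ j ih =>
      intro hj
      calc ‖∫ ω, A (j + 1) ω ∂μ - 1‖
          = ‖(∫ ω, A (j + 1) ω ∂μ - ∫ ω, A j ω ∂μ) + (∫ ω, A j ω ∂μ - 1)‖ := by ring_nf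
        _ ≤ _ := norm_add_le _ _
        _ ≤ Real.exp (τ ^ 2 * n * k ^ 2 / 2) * K
            + j * (Real.exp (τ ^ 2 * n * k ^ 2 / 2) * K) :=
          add_le_add (hstep j hj) (ih (by omega))
        _ = _ := by push_cast; ring
  exact hind n le_rfl

/-- Bounded convergence theorem for convergence in measure to a constant. -/
theorem tendsto_integral_of_tendstoInMeasure_const {Ω : Type*} {m0 : MeasurableSpace Ω}
    {μ : Measure Ω} [IsFiniteMeasure μ] {V : ℕ → Ω → ℝ} {c : ℝ}
    (hV : TendstoInMeasure μ V atTop (fun _ => c)) (hVm : ∀ n, AEStronglyMeasurable (V n) μ)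
    {B : ℝ} (hB : ∀ n, ∀ᵐ ω ∂μ, |V n ω| ≤ B) {g : ℝ → ℝ} (hg : Continuous g) :
    Tendsto (fun n => ∫ ω, g (V n ω) ∂μ) atTop (nhds (∫ _, g c ∂μ)) := by
  obtain ⟨C, hC⟩ := (isCompact_Icc (a := -B) (b := B)).exists_bound_of_continuousOn hg.continuousOn
  refine tendsto_of_subseq_tendsto fun ns hns => ?_
  obtain ⟨ms, hms, hae⟩ := (hV.comp hns).exists_seq_tendsto_ae
  refine ⟨ms, ?_⟩
  refine tendsto_integral_of_dominated_convergence (fun _ => C)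
    (fun n => hg.comp_aestronglyMeasurable (hVm _)) (integrable_const C) (fun n => ?_) ?_
  · filter_upwards [hB (ns (ms n))] with ω h
    exact hC _ (abs_le.1 h)
  · filter_upwards [hae] with ω h
    exact (hg.tendsto c).comp h

/-- Characteristic function convergence in the central limit theorem for bounded martingale
differences. -/
theorem tendsto_integral_cexp_of_bounded_martingale_difference {Ω : Type*} {m0 : MeasurableSpace Ω}
    {μ : Measure Ω} [IsProbabilityMeasure μ] (ℱ : Filtration ℕ m0) {x : ℕ → Ω → ℝ}
    (hxm : ∀ i, StronglyMeasurable[ℱ (i + 1)] (x i)) {k : ℝ}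
    (hx : ∀ i, ∀ᵐ ω ∂μ, |x i ω| ≤ k) (hmd : ∀ i, μ[x i|ℱ i] =ᵐ[μ] 0) {c : ℝ}
    (hvar : TendstoInMeasure μ (fun (n : ℕ) ω => (n : ℝ)⁻¹ * ∑ i ∈ Finset.range n,
      (μ[fun ω' => x i ω' ^ 2|ℱ i]) ω) atTop (fun _ => c)) (t : ℝ) :
    Tendsto (fun n : ℕ => ∫ ω, Complex.exp
        ((t * ((Real.sqrt n)⁻¹ * ∑ i ∈ Finset.range n, x i ω) : ℝ) * Complex.I) ∂μ)
      atTop (nhds (Real.exp (-(t ^ 2 * c / 2)))) := by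
  set v : ℕ → Ω → ℝ := fun i => μ[fun ω => x i ω ^ 2|ℱ i] with hv
  set V : ℕ → Ω → ℝ := fun n ω => (n : ℝ)⁻¹ * ∑ i ∈ Finset.range n, v i ω with hV
  have hxm' : ∀ i, StronglyMeasurable (x i) := fun i => (hxm i).mono (ℱ.le _)
  have hvb : ∀ᵐ ω ∂μ, ∀ i, 0 ≤ v i ω ∧ v i ω ≤ k ^ 2 :=
    ae_all_iff.2 fun i => condExp_sq_bounds (ℱ.le i) (hxm' i).aestronglyMeasurable (hx i)
  have hVm : ∀ n, StronglyMeasurable (V n) := fun n =>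
    (Finset.stronglyMeasurable_fun_sum _ fun i _ =>
      stronglyMeasurable_condExp.mono (ℱ.le i)).const_mul _
  have hVb : ∀ n, ∀ᵐ ω ∂μ, |V n ω| ≤ k ^ 2 := by
    intro n
    filter_upwards [hvb] with ω h
    rw [abs_of_nonneg (mul_nonneg (by positivity) (Finset.sum_nonneg fun i _ => (h i).1))]
    calc V n ω ≤ (n : ℝ)⁻¹ * ∑ i ∈ Finset.range n, k ^ 2 := by
          refine mul_le_mul_of_nonneg_left (Finset.sum_le_sum fun i _ => (h i).2) (by positivity)
      _ = (n : ℝ)⁻¹ * n * k ^ 2 := by simp [mul_assoc]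
      _ ≤ 1 * k ^ 2 := by gcongr; exact inv_mul_le_one
      _ = k ^ 2 := one_mul _
  set Z : ℕ → Ω → ℂ := fun n ω => Complex.exp
    ((t * ((Real.sqrt n)⁻¹ * ∑ i ∈ Finset.range n, x i ω) : ℝ) * Complex.I) with hZ
  have hZm : ∀ n, AEStronglyMeasurable (Z n) μ := fun n =>
    (Complex.continuous_exp.comp_stronglyMeasurable
      ((Complex.continuous_ofReal.comp_stronglyMeasurable
        (((Finset.stronglyMeasurable_fun_sum _ fun i _ => hxm' i).const_mul _).const_mul t)).mul_const
          Complex.I)).aestronglyMeasurable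
  have hZn : ∀ n ω, ‖Z n ω‖ = 1 := fun n ω => Complex.norm_exp_ofReal_mul_I _
  set g : ℝ → ℝ := fun y => Real.exp (t ^ 2 / 2 * (y - c)) with hg
  have hgc : Continuous g := by fun_prop
  have hgi : ∀ n, Integrable (fun ω => (g (V n ω) : ℂ) * Z n ω) μ := by
    intro n
    refine Integrable.of_bound ((Complex.continuous_ofReal.comp_aestronglyMeasurable
      (hgc.comp_aestronglyMeasurable (hVm n).aestronglyMeasurable)).mul (hZm n))
      (Real.exp (t ^ 2 / 2 * (k ^ 2 - c))) ?_
    filter_upwards [hVb n] with ω h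
    rw [norm_mul, hZn, mul_one, Complex.norm_real, Real.norm_eq_abs, abs_of_pos (Real.exp_pos _)]
    have := (le_abs_self _).trans h
    gcongr
  have hZi : ∀ n, Integrable (Z n) μ := fun n =>
    Integrable.of_bound (hZm n) 1 (ae_of_all _ fun ω => (hZn n ω).le)
  -- removing the compensator
  have h1 : Tendsto (fun n => ∫ ω, Z n ω ∂μ - ∫ ω, (g (V n ω) : ℂ) * Z n ω ∂μ) atTop (nhds 0) := by
    have key := tendsto_integral_of_tendstoInMeasure_const hvar
      (fun n => (hVm n).aestronglyMeasurable) hVb (g := fun y => |1 - g y|) (by fun_prop)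
    have : |1 - g c| = 0 := by simp [hg]
    simp only [this, integral_zero] at key
    refine squeeze_zero_norm (fun n => ?_) key
    rw [← integral_sub (hZi n) (hgi n)]
    refine (norm_integral_le_integral_norm _).trans_eq (integral_congr_ae (ae_of_all _ fun ω => ?_))
    have : Z n ω - (g (V n ω) : ℂ) * Z n ω = ((1 - g (V n ω) : ℝ) : ℂ) * Z n ω := by
      push_cast; ring
    beta_reduce
    rw [this, norm_mul, hZn, mul_one, Complex.norm_real, Real.norm_eq_abs]
  -- the compensated exponential
  have h2 : Tendsto (fun n => ∫ ω, (g (V n ω) : ℂ) * Z n ω ∂μ) atTop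
      (nhds (Real.exp (-(t ^ 2 * c / 2)))) := by
    set C : ℝ := (k + k ^ 2 / 2) ^ 3 * Real.exp (k + k ^ 2 / 2) + k ^ 3 / 2 + k ^ 4 / 8 with hC
    have hsq : Tendsto (fun n : ℕ => (Real.sqrt n)⁻¹) atTop (nhds 0) :=
      tendsto_inv_atTop_zero.comp (Real.tendsto_sqrt_atTop.comp tendsto_natCast_atTop_atTop)
    have h3 : Tendsto (fun n : ℕ => Real.exp (-(t ^ 2 * c / 2)) *
        (Real.exp (t ^ 2 * k ^ 2 / 2) * C * |t| ^ 3 * (Real.sqrt n)⁻¹)) atTop (nhds 0) := by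
      simpa using (hsq.const_mul (Real.exp (t ^ 2 * k ^ 2 / 2) * C * |t| ^ 3)).const_mul
        (Real.exp (-(t ^ 2 * c / 2)))
    rw [tendsto_iff_norm_sub_tendsto_zero]
    have hev : ∀ᶠ n : ℕ in atTop, |t * (Real.sqrt n)⁻¹| ≤ 1 := by
      have : Tendsto (fun n : ℕ => |t * (Real.sqrt n)⁻¹|) atTop (nhds 0) := by
        simpa using (hsq.const_mul t).abs
      exact (this.eventually_lt_const one_pos).mono fun n h => h.le
    refine squeeze_zero' (Eventually.of_forall fun n => norm_nonneg _) ?_ h3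
    filter_upwards [hev, eventually_gt_atTop 0] with n hn hn0
    have hnp : (0 : ℝ) < n := by exact_mod_cast hn0
    have hs : Real.sqrt n ^ 2 = n := Real.sq_sqrt hnp.le
    have hs0 : 0 < Real.sqrt n := Real.sqrt_pos.2 hnp
    have hτ2 : (t * (Real.sqrt n)⁻¹) ^ 2 = t ^ 2 * (n : ℝ)⁻¹ := by
      rw [mul_pow, inv_pow, hs]
    have key := norm_integral_cexp_compensated_sub_one_le ℱ hxm hx hmd hn n
    rw [hτ2] at key
    have e1 : ∀ ω, (g (V n ω) : ℂ) * Z n ω = (Real.exp (-(t ^ 2 * c / 2)) : ℂ) *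
        Complex.exp (∑ i ∈ Finset.range n, ((t * (Real.sqrt n)⁻¹ * x i ω : ℝ) * Complex.I
        + (t ^ 2 * (n : ℝ)⁻¹ * v i ω / 2 : ℝ))) := by
      intro ω
      simp only [hg, hZ, hV, Complex.ofReal_exp, ← Complex.exp_add]
      congr 1
      rw [Finset.sum_add_distrib, ← Finset.sum_mul, ← Complex.ofReal_sum, ← Complex.ofReal_sum,
        ← Finset.mul_sum, ← Finset.sum_div, ← Finset.mul_sum]
      push_cast
      ring
    simp_rw [e1]
    rw [integral_const_mul, ← mul_sub_one, norm_mul, Complex.norm_real, Real.norm_eq_abs,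
      abs_of_pos (Real.exp_pos _)]
    refine mul_le_mul_of_nonneg_left (key.trans_eq ?_) (Real.exp_pos _).le
    have e2 : t ^ 2 * (n : ℝ)⁻¹ * n * k ^ 2 / 2 = t ^ 2 * k ^ 2 / 2 := by
      field_simp
    rw [e2, abs_mul, abs_of_pos (inv_pos.2 hs0), ← hC]
    have e3 : (n : ℝ) * ((Real.sqrt n)⁻¹) ^ 3 = (Real.sqrt n)⁻¹ := by
      nth_rewrite 1 [← hs]
      field_simp
    calc _ = Real.exp (t ^ 2 * k ^ 2 / 2) * C * |t| ^ 3 * (n * ((Real.sqrt n)⁻¹) ^ 3) := by ring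
      _ = _ := by rw [e3]
  have h := h1.add h2
  simp only [sub_add_cancel, zero_add] at h
  exact h

/-- **Central limit theorem** for bounded martingale differences. -/
theorem tendstoInDistribution_of_bounded_martingale_difference {Ω : Type*}
    {m0 : MeasurableSpace Ω} {μ : Measure Ω} [IsProbabilityMeasure μ] (ℱ : Filtration ℕ m0)
    {x : ℕ → Ω → ℝ} (hxm : ∀ i, StronglyMeasurable[ℱ (i + 1)] (x i)) {k : ℝ}
    (hx : ∀ i, ∀ᵐ ω ∂μ, |x i ω| ≤ k) (hmd : ∀ i, μ[x i|ℱ i] =ᵐ[μ] 0) {c : NNReal}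
    (hvar : TendstoInMeasure μ (fun (n : ℕ) ω => (n : ℝ)⁻¹ * ∑ i ∈ Finset.range n,
      (μ[fun ω' => x i ω' ^ 2|ℱ i]) ω) atTop (fun _ => (c : ℝ))) :
    TendstoInDistribution (fun (n : ℕ) ω => (Real.sqrt n)⁻¹ * ∑ i ∈ Finset.range n, x i ω) atTop
      id (fun _ => μ) (ProbabilityTheory.gaussianReal 0 c) where
  forall_aemeasurable n := ((Finset.stronglyMeasurable_fun_sum _ fun i _ =>
    (hxm i).mono (ℱ.le _)).const_mul _).measurable.aemeasurable
  aemeasurable_limit := aemeasurable_id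
  tendsto := by
    refine ProbabilityMeasure.tendsto_iff_tendsto_charFun.2 fun t => ?_
    have hm : ∀ n : ℕ, AEMeasurable
        (fun ω => (Real.sqrt n)⁻¹ * ∑ i ∈ Finset.range n, x i ω) μ := fun n =>
      ((Finset.stronglyMeasurable_fun_sum _ fun i _ =>
        (hxm i).mono (ℱ.le _)).const_mul _).measurable.aemeasurable
    have h := tendsto_integral_cexp_of_bounded_martingale_difference ℱ hxm hx hmd hvar t
    simp only [ProbabilityMeasure.coe_mk, Measure.map_id, ProbabilityTheory.charFun_gaussianReal]
    convert h using 2 with n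
    · rw [charFun_apply_real, integral_map (hm n) (by fun_prop)]
      simp
    · push_cast
      ring_nf

theorem integral_add_add {Ω : Type*} {m0 : MeasurableSpace Ω} {μ : Measure Ω} {f g h : Ω → ℝ}
    (hf : Integrable f μ) (hg : Integrable g μ) (hh : Integrable h μ) :
    ∫ ω, (f ω + g ω + h ω) ∂μ = ∫ ω, f ω ∂μ + ∫ ω, g ω ∂μ + ∫ ω, h ω ∂μ := by
  have h1 : Integrable (fun ω => f ω + g ω) μ := hf.add hg
  rw [integral_add h1 hh, integral_add hf hg]

/-- Exponential moment bound for compensated sums of bounded adapted random variables. -/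
theorem integral_exp_compensated_le {Ω : Type*} {m0 : MeasurableSpace Ω}
    {μ : Measure Ω} [IsProbabilityMeasure μ] (ℱ : Filtration ℕ m0) {Y : ℕ → Ω → ℝ}
    (hYm : ∀ i, StronglyMeasurable[ℱ (i + 1)] (Y i)) (hY : ∀ i, ∀ᵐ ω ∂μ, |Y i ω| ≤ 1) {q : ℝ}
    (hq : ∀ i, ∀ᵐ ω ∂μ, (μ[fun ω' => Y i ω' ^ 2|ℱ i]) ω ≤ q) (n : ℕ) :
    Integrable (fun ω => Real.exp (∑ i ∈ Finset.range n, (Y i ω - (μ[Y i|ℱ i]) ω))) μ ∧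
    ∫ ω, Real.exp (∑ i ∈ Finset.range n, (Y i ω - (μ[Y i|ℱ i]) ω)) ∂μ ≤ Real.exp (n * q) := by
  set m : ℕ → Ω → ℝ := fun i => μ[Y i|ℱ i] with hm
  set A : ℕ → Ω → ℝ := fun n ω => Real.exp (∑ i ∈ Finset.range n, (Y i ω - m i ω)) with hA
  have hYm' : ∀ i, StronglyMeasurable (Y i) := fun i => (hYm i).mono (ℱ.le _)
  have hYi : ∀ i, Integrable (Y i) μ := fun i =>
    Integrable.of_bound (hYm' i).aestronglyMeasurable 1 (hY i)
  have hY2i : ∀ i, Integrable (fun ω => Y i ω ^ 2) μ := fun i => by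
    refine Integrable.of_bound ((hYm' i).pow 2).aestronglyMeasurable 1 ?_
    filter_upwards [hY i] with ω h
    rw [norm_pow]
    exact pow_le_one₀ (norm_nonneg _) h
  have hmm : ∀ i, StronglyMeasurable[ℱ i] (m i) := fun i => stronglyMeasurable_condExp
  have hmb : ∀ᵐ ω ∂μ, ∀ i, |m i ω| ≤ 1 := ae_all_iff.2 fun i =>
    ae_bdd_abs_condExp_of_ae_bdd_abs (hY i)
  have hYb : ∀ᵐ ω ∂μ, ∀ i, |Y i ω| ≤ 1 := ae_all_iff.2 hY
  have hAm : ∀ n, StronglyMeasurable[ℱ n] (A n) := by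
    intro n
    refine Real.continuous_exp.comp_stronglyMeasurable ?_
    refine Finset.stronglyMeasurable_fun_sum _ fun i hi => ?_
    have := Finset.mem_range.1 hi
    exact ((hYm i).mono (ℱ.mono this)).sub ((hmm i).mono (ℱ.mono this.le))
  have hAb : ∀ n, ∀ᵐ ω ∂μ, ‖A n ω‖ ≤ Real.exp (n * 2) := by
    intro n
    filter_upwards [hmb, hYb] with ω h1 h2
    rw [Real.norm_eq_abs, abs_of_pos (Real.exp_pos _), Real.exp_le_exp]
    calc _ ≤ ∑ i ∈ Finset.range n, (2 : ℝ) := Finset.sum_le_sum fun i _ => by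
          have := abs_le.1 (h1 i); have := abs_le.1 (h2 i); linarith
      _ = _ := by simp
  have hAi : ∀ n, Integrable (A n) μ := fun n =>
    Integrable.of_bound ((hAm n).mono (ℱ.le n)).aestronglyMeasurable _ (hAb n)
  refine ⟨hAi n, ?_⟩
  induction n with
  | zero => simp
  | succ j ih =>
    set G : Ω → ℝ := fun ω => A j ω * Real.exp (-m j ω) with hG
    have hGm : StronglyMeasurable[ℱ j] G :=
      (hAm j).mul (Real.continuous_exp.comp_stronglyMeasurable (hmm j).neg)
    have hGm' := (hGm.mono (ℱ.le j)).aestronglyMeasurable (μ := μ)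
    have hGb : ∀ᵐ ω ∂μ, ‖G ω‖ ≤ Real.exp (j * 2) * Real.exp 1 := by
      filter_upwards [hAb j, hmb] with ω h1 h2
      have := (abs_le.1 (h2 j)).1
      rw [hG, norm_mul, Real.norm_eq_abs (Real.exp (-m j ω)), abs_of_pos (Real.exp_pos _)]
      exact mul_le_mul h1 (Real.exp_le_exp.2 (by linarith)) (Real.exp_pos _).le (Real.exp_pos _).le
    have hGi : Integrable G μ := Integrable.of_bound hGm' _ hGb
    have i1 := integrable_smul_of_bound hGm' (hYi j) _ hGb
    have i2 := integrable_smul_of_bound hGm' (hY2i j) _ hGb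
    have i1' := integrable_smul_of_bound hGm' (integrable_condExp (m := ℱ j) (f := Y j)) _ hGb
    have i2' := integrable_smul_of_bound hGm'
      (integrable_condExp (m := ℱ j) (f := fun ω => Y j ω ^ 2)) _ hGb
    calc ∫ ω, A (j + 1) ω ∂μ ≤ ∫ ω, (G ω + Y j ω • G ω + Y j ω ^ 2 • G ω) ∂μ := by
          refine integral_mono_ae (hAi _) ((hGi.add i1).add i2) ?_
          filter_upwards [hY j] with ω h
          have h1 : A (j + 1) ω = G ω * Real.exp (Y j ω) := by
            simp only [hG, hA, Finset.sum_range_succ, ← Real.exp_add]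
            ring_nf
          have h2 := (abs_le.1 (Real.abs_exp_sub_one_sub_id_le h)).2
          have h3 : 0 ≤ G ω := by positivity
          rw [h1]
          simp only [smul_eq_mul]
          nlinarith
      _ = ∫ ω, (G ω + m j ω • G ω + (μ[fun ω' => Y j ω' ^ 2|ℱ j]) ω • G ω) ∂μ := by
          rw [integral_add_add hGi i1 i2, integral_add_add hGi i1' i2',
            integral_condExp_smul_of_bound (ℱ.le j) hGm (hYi j) _ hGb,
            integral_condExp_smul_of_bound (ℱ.le j) hGm (hY2i j) _ hGb]
      _ ≤ ∫ ω, Real.exp q * A j ω ∂μ := by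
          refine integral_mono_ae ((hGi.add i1').add i2') ((hAi j).const_mul _) ?_
          filter_upwards [hq j] with ω h
          have h3 : 0 ≤ G ω := by positivity
          have h1 : Real.exp q * A j ω = G ω * Real.exp (m j ω + q) := by
            simp only [hG, hA, ← Real.exp_add]
            ring_nf
          have h2 := Real.add_one_le_exp (m j ω + q)
          rw [h1]
          simp only [smul_eq_mul]
          nlinarith
      _ ≤ Real.exp q * Real.exp (j * q) := by
          rw [integral_const_mul]
          exact mul_le_mul_of_nonneg_left ih (Real.exp_pos _).le
      _ = Real.exp ((j + 1 : ℕ) * q) := by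
          rw [← Real.exp_add]; push_cast; ring_nf

/-- Sums of square integrable martingale differences are orthogonal. -/
theorem integral_sq_sum_martingale_difference {Ω : Type*} {m0 : MeasurableSpace Ω}
    {μ : Measure Ω} [IsProbabilityMeasure μ] (ℱ : Filtration ℕ m0) {Y : ℕ → Ω → ℝ}
    (hYm : ∀ i, StronglyMeasurable[ℱ (i + 1)] (Y i)) (hY : ∀ i, MemLp (Y i) 2 μ)
    (hmd : ∀ i, μ[Y i|ℱ i] =ᵐ[μ] 0) (n : ℕ) :
    ∫ ω, (∑ i ∈ Finset.range n, Y i ω) ^ 2 ∂μ = ∑ i ∈ Finset.range n, ∫ ω, Y i ω ^ 2 ∂μ := by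
  induction n with
  | zero => simp
  | succ j ih =>
    set T : Ω → ℝ := fun ω => ∑ i ∈ Finset.range j, Y i ω with hT
    have hTm : StronglyMeasurable[ℱ j] T := Finset.stronglyMeasurable_fun_sum _ fun i hi =>
      (hYm i).mono (ℱ.mono (Finset.mem_range.1 hi))
    have hT2 : MemLp T 2 μ := memLp_finsetSum _ fun i _ => hY i
    have hTY : Integrable (T * Y j) μ := hT2.integrable_mul (hY j)
    have h0 : ∫ ω, T ω * Y j ω ∂μ = 0 := by
      have h := condExp_mul_of_stronglyMeasurable_left hTm hTY ((hY j).integrable one_le_two)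
      have h2 := integral_condExp (ℱ.le j) (μ := μ) (f := T * Y j)
      change ∫ ω, (T * Y j) ω ∂μ = 0
      rw [← h2, integral_eq_zero_of_ae]
      filter_upwards [h, hmd j] with ω a b
      simp [a, b]
    have e : ∀ ω, (∑ i ∈ Finset.range (j + 1), Y i ω) ^ 2
        = T ω ^ 2 + 2 * (T ω * Y j ω) + Y j ω ^ 2 := by
      intro ω
      rw [Finset.sum_range_succ]
      simp only [hT]
      ring
    have hTY2 : Integrable (fun ω => 2 * (T ω * Y j ω)) μ := hTY.const_mul 2
    simp_rw [e]
    rw [integral_add_add hT2.integrable_sq hTY2 (hY j).integrable_sq, integral_const_mul, h0,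
      ih, Finset.sum_range_succ]
    ring

/-- Truncation: sums of martingale differences dominated by `√W` are, up to an error controlled by
`W`, random variables with exponential moments. -/
theorem exists_exp_moment_approx {Ω : Type*} {m0 : MeasurableSpace Ω}
    {μ : Measure Ω} [IsProbabilityMeasure μ] (ℱ : Filtration ℕ m0) {Y W : ℕ → Ω → ℝ}
    (hYm : ∀ i, StronglyMeasurable[ℱ (i + 1)] (Y i)) (hmd : ∀ i, μ[Y i|ℱ i] =ᵐ[μ] 0)
    (hWm : ∀ i, StronglyMeasurable[ℱ (i + 1)] (W i)) (hWi : ∀ i, Integrable (W i) μ)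
    (hY : ∀ i, ∀ᵐ ω ∂μ, Y i ω ^ 2 ≤ W i ω) {b : ℝ}
    (hWb : ∀ i, ∀ᵐ ω ∂μ, (μ[W i|ℱ i]) ω ≤ b) (n : ℕ) :
    ∃ T : Ω → ℝ, (Integrable (fun ω => Real.exp (T ω)) μ ∧
        ∫ ω, Real.exp (T ω) ∂μ ≤ Real.exp (n * b)) ∧
      (Integrable (fun ω => Real.exp (-T ω)) μ ∧
        ∫ ω, Real.exp (-T ω) ∂μ ≤ Real.exp (n * b)) ∧
      ∀ᵐ ω ∂μ, |∑ i ∈ Finset.range n, Y i ω - T ω|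
        ≤ ∑ i ∈ Finset.range n, (W i ω + (μ[W i|ℱ i]) ω) := by
  set A : ℕ → Set Ω := fun i => {ω | W i ω ≤ 1} with hA
  have hAm : ∀ i, MeasurableSet[ℱ (i + 1)] (A i) := fun i =>
    measurableSet_le (hWm i).measurable measurable_const
  set Z : ℕ → Ω → ℝ := fun i => (A i).indicator (Y i) with hZ
  have hZm : ∀ i, StronglyMeasurable[ℱ (i + 1)] (Z i) := fun i => (hYm i).indicator (hAm i)
  have hYi : ∀ i, Integrable (Y i) μ := fun i => by
    have hm := ((hYm i).mono (ℱ.le _)).aestronglyMeasurable (μ := μ)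
    refine (MemLp.integrable one_le_two ((memLp_two_iff_integrable_sq hm).2 ?_))
    refine (hWi i).mono' (hm.pow 2) ?_
    filter_upwards [hY i] with ω h
    rwa [Real.norm_eq_abs, abs_of_nonneg (sq_nonneg _)]
  have hZi : ∀ i, Integrable (Z i) μ := fun i => (hYi i).indicator (ℱ.le _ _ (hAm i))
  have hZY : ∀ i ω, Z i ω ^ 2 ≤ Y i ω ^ 2 := by
    intro i ω
    by_cases h : ω ∈ A i
    · simp [hZ, h]
    · simpa [hZ, h] using sq_nonneg (Y i ω)
  have hZ1 : ∀ i, ∀ᵐ ω ∂μ, |Z i ω| ≤ 1 := by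
    intro i
    filter_upwards [hY i] with ω h
    by_cases hω : ω ∈ A i
    · simp only [hZ, Set.indicator_of_mem hω]
      exact abs_le_one_iff_mul_self_le_one.2 (by have : W i ω ≤ 1 := hω; nlinarith)
    · simp [hZ, hω]
  have hZb : ∀ i, ∀ᵐ ω ∂μ, (μ[fun ω' => Z i ω' ^ 2|ℱ i]) ω ≤ b := by
    intro i
    have hle : (fun ω => Z i ω ^ 2) ≤ᵐ[μ] W i := by
      filter_upwards [hY i] with ω h using (hZY i ω).trans h
    have hi : Integrable (fun ω => Z i ω ^ 2) μ := by
      refine (hWi i).mono' (((hZm i).mono (ℱ.le _)).pow 2).aestronglyMeasurable ?_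
      filter_upwards [hle] with ω h
      rwa [Real.norm_eq_abs, abs_of_nonneg (sq_nonneg _)]
    filter_upwards [condExp_mono (m := ℱ i) hi (hWi i) hle, hWb i] with ω h1 h2 using h1.trans h2
  have hrem : ∀ i, ∀ᵐ ω ∂μ, |Y i ω - Z i ω| ≤ W i ω := by
    intro i
    filter_upwards [hY i] with ω h
    by_cases hω : ω ∈ A i
    · simp only [hZ, Set.indicator_of_mem hω, sub_self, abs_zero]
      nlinarith
    · simp only [hZ, Set.indicator_of_notMem hω, sub_zero]
      have : 1 < W i ω := not_le.1 hω
      exact abs_le_of_sq_le_sq (by nlinarith) (by linarith)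
  have hcomp : ∀ i, ∀ᵐ ω ∂μ, |(μ[Z i|ℱ i]) ω| ≤ (μ[W i|ℱ i]) ω := by
    intro i
    have hi := (hYi i).sub (hZi i)
    have h1 := condExp_mono (m := ℱ i) hi (hWi i) (by
      filter_upwards [hrem i] with ω h using (abs_le.1 h).2)
    have h2 := condExp_mono (m := ℱ i) hi.neg (hWi i) (by
      filter_upwards [hrem i] with ω h
      have := (abs_le.1 h).1
      simp only [Pi.neg_apply, Pi.sub_apply]
      linarith)
    filter_upwards [h1, h2, condExp_sub (hYi i) (hZi i) (ℱ i), condExp_neg (Y i - Z i) (ℱ i),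
      hmd i] with ω a1 a2 a3 a4 a5
    rw [a4, Pi.neg_apply] at a2
    rw [a3] at a1 a2
    simp only [Pi.sub_apply, a5, Pi.zero_apply] at a1 a2
    exact abs_le.2 ⟨by linarith, by linarith⟩
  refine ⟨fun ω => ∑ i ∈ Finset.range n, (Z i ω - (μ[Z i|ℱ i]) ω),
    integral_exp_compensated_le ℱ hZm hZ1 hZb n, ?_, ?_⟩
  · have h := integral_exp_compensated_le ℱ (Y := fun i => -Z i) (fun i => (hZm i).neg)
      (by simpa using hZ1) (by simpa using hZb) n
    have hae : (fun ω => Real.exp (∑ i ∈ Finset.range n, ((-Z i) ω - (μ[-Z i|ℱ i]) ω))) =ᵐ[μ]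
        fun ω => Real.exp (-∑ i ∈ Finset.range n, (Z i ω - (μ[Z i|ℱ i]) ω)) := by
      filter_upwards [ae_all_iff.2 fun i => condExp_neg (Z i) (ℱ i)] with ω hω
      rw [← Finset.sum_neg_distrib]
      congr 1
      refine Finset.sum_congr rfl fun i _ => ?_
      rw [hω i]
      simp only [Pi.neg_apply]
      ring
    exact ⟨h.1.congr hae, (integral_congr_ae hae).symm.trans_le h.2⟩
  · filter_upwards [ae_all_iff.2 hrem, ae_all_iff.2 hcomp] with ω h1 h2
    rw [← Finset.sum_sub_distrib]
    refine (Finset.abs_sum_le_sum_abs _ _).trans (Finset.sum_le_sum fun i _ => ?_)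
    have e : Y i ω - (Z i ω - (μ[Z i|ℱ i]) ω) = (Y i ω - Z i ω) + (μ[Z i|ℱ i]) ω := by ring
    rw [e]
    exact (abs_add_le _ _).trans (add_le_add (h1 i) (h2 i))

/-- Maximal inequality for finitely many random variables with a common bound on exponential
moments. -/
theorem exists_integrable_max_bound {Ω : Type*} {m0 : MeasurableSpace Ω}
    {μ : Measure Ω} [IsProbabilityMeasure μ] {ι : Type*} {F : Finset ι} (hF : F.Nonempty)
    {T : ι → Ω → ℝ} {B : ℝ}
    (h1 : ∀ u, Integrable (fun ω => Real.exp (T u ω)) μ ∧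
      ∫ ω, Real.exp (T u ω) ∂μ ≤ Real.exp B)
    (h2 : ∀ u, Integrable (fun ω => Real.exp (-T u ω)) μ ∧
      ∫ ω, Real.exp (-T u ω) ∂μ ≤ Real.exp B) :
    ∃ M : Ω → ℝ, Integrable M μ ∧ (∀ ω, ∀ u ∈ F, |T u ω| ≤ M ω) ∧
      ∫ ω, M ω ∂μ ≤ Real.log (2 * F.card) + B := by
  set L : ℝ := Real.log (2 * F.card) + B with hL
  have hN : (0 : ℝ) < 2 * F.card := by
    have := hF.card_pos
    positivity
  have hi : ∀ u, Integrable (fun ω => Real.exp (T u ω) + Real.exp (-T u ω)) μ := fun u =>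
    (h1 u).1.add (h2 u).1
  have hs : Integrable (fun ω => ∑ u ∈ F, (Real.exp (T u ω) + Real.exp (-T u ω))) μ :=
    integrable_finsetSum _ fun u _ => hi u
  refine ⟨fun ω => (L - 1) + Real.exp (-L) * ∑ u ∈ F, (Real.exp (T u ω) + Real.exp (-T u ω)),
    (integrable_const _).add (hs.const_mul _), fun ω u hu => ?_, ?_⟩
  · have e1 := Real.add_one_le_exp (|T u ω| - L)
    have e2 : Real.exp (|T u ω|) ≤ ∑ u ∈ F, (Real.exp (T u ω) + Real.exp (-T u ω)) :=
      (Real.exp_abs_le _).trans (Finset.single_le_sum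
        (f := fun u => Real.exp (T u ω) + Real.exp (-T u ω)) (fun i _ => by positivity) hu)
    have e3 : Real.exp (|T u ω| - L) = Real.exp (-L) * Real.exp |T u ω| := by
      rw [← Real.exp_add]; ring_nf
    have e4 := mul_le_mul_of_nonneg_left e2 (Real.exp_pos (-L)).le
    linarith
  · rw [integral_add (integrable_const _) (hs.const_mul _), integral_const_mul,
      integral_finsetSum _ fun u _ => hi u]
    have e1 : ∑ u ∈ F, ∫ ω, (Real.exp (T u ω) + Real.exp (-T u ω)) ∂μ
        ≤ 2 * F.card * Real.exp B := by
      calc _ ≤ ∑ u ∈ F, (2 * Real.exp B) := Finset.sum_le_sum fun u _ => by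
            rw [integral_add (h1 u).1 (h2 u).1]
            linarith [(h1 u).2, (h2 u).2]
        _ = _ := by simp; ring
    have e2 : Real.exp (-L) * (2 * F.card * Real.exp B) = 1 := by
      rw [hL, ← Real.exp_log hN, ← Real.exp_add, ← Real.exp_add, Real.log_exp]
      simp
    have e3 := mul_le_mul_of_nonneg_left e1 (Real.exp_pos (-L)).le
    simp only [integral_const, probReal_univ, one_smul]
    linarith

/-- Chaining step: a maximal inequality for normalized sums over finitely many martingale
difference sequences dominated by `r √W`. -/
theorem exists_integrable_link_bound {Ω : Type*} {m0 : MeasurableSpace Ω}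
    {μ : Measure Ω} [IsProbabilityMeasure μ] (ℱ : Filtration ℕ m0) {ι : Type*} {F : Finset ι}
    (hF : F.Nonempty) {Y : ι → ℕ → Ω → ℝ} {W : ℕ → Ω → ℝ}
    (hYm : ∀ u i, StronglyMeasurable[ℱ (i + 1)] (Y u i))
    (hmd : ∀ u i, μ[Y u i|ℱ i] =ᵐ[μ] 0)
    (hWm : ∀ i, StronglyMeasurable[ℱ (i + 1)] (W i)) (hWi : ∀ i, Integrable (W i) μ) {b : ℝ}
    (hWb : ∀ i, ∀ᵐ ω ∂μ, (μ[W i|ℱ i]) ω ≤ b) {r h : ℝ} (hr : 0 < r) (hh : 0 < h)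
    (hcard : 1 + Real.log F.card ≤ h ^ 2)
    (hY : ∀ u i, ∀ᵐ ω ∂μ, Y u i ω ^ 2 ≤ r ^ 2 * W i ω) {n : ℕ} (hn : 0 < n) :
    ∃ Q : Ω → ℝ, Integrable Q μ ∧
      (∀ᵐ ω ∂μ, ∀ u ∈ F, |(Real.sqrt n)⁻¹ * ∑ i ∈ Finset.range n, Y u i ω| ≤ Q ω) ∧
      ∫ ω, Q ω ∂μ ≤ r * h * (1 + b + 2 * ((n : ℝ)⁻¹ * ∑ i ∈ Finset.range n, ∫ ω, W i ω ∂μ)) := by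
  have hnp : (0 : ℝ) < n := by exact_mod_cast hn
  have hs0 : 0 < Real.sqrt n := Real.sqrt_pos.2 hnp
  have hs : Real.sqrt n ^ 2 = n := Real.sq_sqrt hnp.le
  set l : ℝ := h / (r * Real.sqrt n) with hl
  have hl0 : 0 < l := by positivity
  have hl2 : l ^ 2 * r ^ 2 = h ^ 2 / n := by
    rw [hl, div_pow, mul_pow, hs]
    field_simp
  set s : ℝ := h ^ 2 / n with hsdef
  have hsp : 0 < s := by positivity
  have hsW : ∀ i, μ[fun ω => s * W i ω|ℱ i] =ᵐ[μ] fun ω => s * (μ[W i|ℱ i]) ω := fun i =>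
    condExp_smul s (W i) (ℱ i)
  have key : ∀ u, _ := fun u => exists_exp_moment_approx (μ := μ) ℱ
    (Y := fun i ω => l * Y u i ω) (W := fun i ω => s * W i ω) (b := s * b)
    (fun i => (hYm u i).const_mul l)
    (fun i => by
      filter_upwards [condExp_smul l (Y u i) (ℱ i) (μ := μ), hmd u i] with ω h1 h2
      refine h1.trans ?_
      simp [h2])
    (fun i => (hWm i).const_mul s) (fun i => (hWi i).const_mul s)
    (fun i => by
      filter_upwards [hY u i] with ω h1
      calc (l * Y u i ω) ^ 2 = l ^ 2 * Y u i ω ^ 2 := by ring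
        _ ≤ l ^ 2 * (r ^ 2 * W i ω) := by gcongr
        _ = _ := by rw [← mul_assoc, hl2])
    (fun i => by
      filter_upwards [hsW i, hWb i] with ω h1 h2
      rw [h1]
      gcongr) n
  choose T hT1 hT2 hT3 using key
  obtain ⟨M, hMi, hMb, hMint⟩ := exists_integrable_max_bound hF hT1 hT2
  have hi : ∀ i, Integrable (fun ω => W i ω + (μ[W i|ℱ i]) ω) μ := fun i =>
    (hWi i).add integrable_condExp
  have hRi : Integrable (fun ω => ∑ i ∈ Finset.range n, (W i ω + (μ[W i|ℱ i]) ω)) μ :=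
    integrable_finsetSum _ fun i _ => hi i
  refine ⟨fun ω => (r / h) * (M ω + s * ∑ i ∈ Finset.range n, (W i ω + (μ[W i|ℱ i]) ω)),
    (hMi.add (hRi.const_mul _)).const_mul _, ?_, ?_⟩
  · have hall : ∀ᵐ ω ∂μ, ∀ u ∈ F, |∑ i ∈ Finset.range n, l * Y u i ω - T u ω|
        ≤ ∑ i ∈ Finset.range n, (s * W i ω + (μ[fun ω => s * W i ω|ℱ i]) ω) :=
      (ae_ball_iff F.countable_toSet).2 fun u _ => hT3 u
    filter_upwards [hall, ae_all_iff.2 hsW] with ω h1 h2 u hu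
    have a1 := h1 u hu
    have a2 := hMb ω u hu
    simp only [h2, ← mul_add, ← Finset.mul_sum] at a1
    have a3 : |l * ∑ i ∈ Finset.range n, Y u i ω| ≤
        M ω + s * ∑ i ∈ Finset.range n, (W i ω + (μ[W i|ℱ i]) ω) := by
      have := abs_add_le (l * ∑ i ∈ Finset.range n, Y u i ω - T u ω) (T u ω)
      rw [sub_add_cancel] at this
      linarith
    have e : (Real.sqrt n)⁻¹ * ∑ i ∈ Finset.range n, Y u i ω
        = (r / h) * (l * ∑ i ∈ Finset.range n, Y u i ω) := by
      rw [hl]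
      field_simp
    rw [e, abs_mul, abs_of_pos (by positivity : 0 < r / h)]
    gcongr
  · rw [integral_const_mul, integral_add hMi (hRi.const_mul _), integral_const_mul,
      integral_finsetSum _ fun i _ => hi i]
    have e1 : ∀ i, ∫ ω, (W i ω + (μ[W i|ℱ i]) ω) ∂μ = 2 * ∫ ω, W i ω ∂μ := fun i => by
      rw [integral_add (hWi i) integrable_condExp, integral_condExp (ℱ.le i)]
      ring
    simp_rw [e1]
    have hc0 : (0 : ℝ) < F.card := by exact_mod_cast hF.card_pos
    have e2 : Real.log (2 * F.card) ≤ h ^ 2 := by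
      rw [Real.log_mul two_ne_zero hc0.ne']
      linarith [Real.log_two_lt_d9]
    have e3 : (n : ℝ) * (s * b) = h ^ 2 * b := by
      rw [hsdef]; field_simp
    rw [e3] at hMint
    rw [← Finset.mul_sum]
    calc _ ≤ r / h * (h ^ 2 + h ^ 2 * b + s * (2 * ∑ i ∈ Finset.range n, ∫ ω, W i ω ∂μ)) := by
          gcongr; linarith
      _ = _ := by rw [hsdef]; field_simp

/-- The covering number is attained by a finite net. -/
theorem exists_finset_net_card {S : Type*} [TopologicalSpace S] [CompactSpace S]
    {ρ : S → S → ℝ} (hρ : Continuous fun p : S × S => ρ p.1 p.2) (hρ0 : ∀ s, ρ s s = 0)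
    {r : ℝ} (hr : 0 < r) :
    ∃ t : Finset S, (∀ s, ∃ c ∈ t, ρ s c ≤ r) ∧ coveringNumber ρ r = t.card := by
  have hex : ∃ n, ∃ t : Finset S, (∀ s, ∃ c ∈ t, ρ s c ≤ r) ∧ t.card = n := by
    obtain ⟨t, -, ht⟩ := isCompact_univ.elim_nhds_subcover (fun c : S => {s | ρ s c < r})
      fun c _ => (isOpen_lt (hρ.comp (Continuous.prodMk_left c)) continuous_const).mem_nhds
        (by simpa [hρ0] using hr)
    refine ⟨_, t, fun s => ?_, rfl⟩
    obtain ⟨c, hc, h⟩ := Set.mem_iUnion₂.1 (ht (Set.mem_univ s))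
    exact ⟨c, hc, le_of_lt h⟩
  classical
  obtain ⟨t, ht, hcard⟩ := Nat.find_spec hex
  refine ⟨t, ht, le_antisymm (iInf₂_le t ht) (le_iInf₂ fun u hu => ?_)⟩
  rw [hcard]
  exact_mod_cast Nat.find_min' hex ⟨u, hu, rfl⟩

/-- Metric entropy decreases with the radius. -/
theorem antitoneOn_metricEntropy {S : Type*} [TopologicalSpace S] [CompactSpace S] [Nonempty S]
    {ρ : S → S → ℝ} (hρ : Continuous fun p : S × S => ρ p.1 p.2) (hρ0 : ∀ s, ρ s s = 0) :
    AntitoneOn (metricEntropy ρ) (Set.Ioi 0) := by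
  intro r hr r' hr' hrr'
  obtain ⟨t, ht, h⟩ := exists_finset_net_card hρ hρ0 hr
  obtain ⟨t', ht', h'⟩ := exists_finset_net_card hρ hρ0 hr'
  have hle : coveringNumber ρ r' ≤ coveringNumber ρ r := by
    rw [h]
    exact iInf₂_le t fun s => (ht s).imp fun c hc => ⟨hc.1, hc.2.trans hrr'⟩
  rw [h, h', Nat.cast_le] at hle
  have hpos : 0 < t'.card := by
    obtain ⟨c, hc, -⟩ := ht' (Classical.arbitrary S)
    exact Finset.card_pos.2 ⟨c, hc⟩
  simp only [metricEntropy, h, h', ENat.toNat_natCast]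
  exact Real.log_le_log (by exact_mod_cast hpos) (by exact_mod_cast hle)

/-- A dyadic form of the integral test for a singularity at zero. -/
theorem summable_dyadic_of_integrableOn {g : ℝ → ℝ} (hg : AntitoneOn g (Set.Ioi 0))
    (hg0 : ∀ r, 0 ≤ g r) (hi : IntegrableOn g (Set.Ioc 0 1)) :
    Summable fun k : ℕ => (1 / 2 : ℝ) ^ k * g ((1 / 2) ^ (k + 1)) := by
  set I : ℕ → Set ℝ := fun k => Set.Ioc ((1 / 2 : ℝ) ^ (k + 1 + 1)) ((1 / 2) ^ (k + 1)) with hI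
  have hanti : Antitone fun k : ℕ => (1 / 2 : ℝ) ^ (k + 1) := fun a b hab =>
    pow_le_pow_of_le_one (by norm_num) (by norm_num) (by omega)
  have hdisj : Pairwise (Function.onFun Disjoint I) := hanti.pairwise_disjoint_on_Ioc_succ
  have hsub : ∀ k, I k ⊆ Set.Ioc 0 1 := fun k x hx =>
    ⟨lt_trans (by positivity) hx.1, hx.2.trans (pow_le_one₀ (by norm_num) (by norm_num))⟩
  have hsum := (hasSum_integral_iUnion (μ := volume) (f := g) (s := I)
    (fun k => measurableSet_Ioc) hdisj (hi.mono_set (Set.iUnion_subset hsub))).summable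
  refine Summable.of_nonneg_of_le (fun k => mul_nonneg (by positivity) (hg0 _)) (fun k => ?_)
    (hsum.mul_left 4)
  have hle : ∫ _ in I k, g ((1 / 2) ^ (k + 1)) ≤ ∫ x in I k, g x := by
    refine setIntegral_mono_on (integrableOn_const (by simp [hI])) (hi.mono_set (hsub k))
      measurableSet_Ioc fun x hx => ?_
    exact hg (hsub k hx).1 (Set.mem_Ioi.2 (by positivity)) hx.2
  have hvol : volume.real (I k) = (1 / 2 : ℝ) ^ (k + 2) := by
    rw [hI, Real.volume_real_Ioc_of_le (hanti (Nat.le_succ k))]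
    simp only [Nat.succ_eq_add_one]
    ring
  rw [setIntegral_const, hvol, smul_eq_mul] at hle
  calc _ = 4 * ((1 / 2 : ℝ) ^ (k + 2) * g ((1 / 2) ^ (k + 1))) := by ring
    _ ≤ _ := by gcongr

/-- Nets at dyadic scales whose weighted root log-cardinalities are summable. -/
theorem exists_dyadic_nets {S : Type*} [TopologicalSpace S] [CompactSpace S] [Nonempty S]
    {ρ : S → S → ℝ} (hρ : Continuous fun p : S × S => ρ p.1 p.2) (hρ0 : ∀ s, ρ s s = 0)
    (hent : IntegrableOn (fun r => Real.sqrt (metricEntropy ρ r)) (Set.Ioc (0 : ℝ) 1)) :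
    ∃ (T : ℕ → Finset S) (p : ℕ → S → S) (h : ℕ → ℝ), (∀ k s, p k s ∈ T k) ∧
      (∀ k s, ρ s (p k s) ≤ (1 / 2) ^ k) ∧ (∀ k, 0 < h k) ∧
      (∀ k, 1 + Real.log (T (k + 1)).card ≤ h k ^ 2) ∧
      Summable fun k => (1 / 2 : ℝ) ^ k * h k := by
  have hT : ∀ k : ℕ, _ := fun k =>
    exists_finset_net_card hρ hρ0 (r := (1 / 2 : ℝ) ^ k) (by positivity)
  choose T hT1 hT2 using hT
  choose p hp1 hp2 using hT1
  refine ⟨T, p, fun k => 1 + Real.sqrt (metricEntropy ρ ((1 / 2) ^ (k + 1))), hp1, hp2,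
    fun k => by positivity, fun k => ?_, ?_⟩
  · have e : Real.log (T (k + 1)).card = metricEntropy ρ ((1 / 2) ^ (k + 1)) := by
      rw [metricEntropy, hT2, ENat.toNat_natCast]
    have h0 : 0 ≤ metricEntropy ρ ((1 / 2) ^ (k + 1)) := Real.log_natCast_nonneg _
    rw [e]
    nlinarith [Real.sq_sqrt h0, Real.sqrt_nonneg (metricEntropy ρ ((1 / 2) ^ (k + 1)))]
  · have h1 := summable_dyadic_of_integrableOn
      (fun x hx y hy hxy => Real.sqrt_le_sqrt (antitoneOn_metricEntropy hρ hρ0 hx hy hxy))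
      (fun r => Real.sqrt_nonneg _) hent
    have h2 : Summable fun k : ℕ => (1 / 2 : ℝ) ^ k :=
      summable_geometric_of_lt_one (by norm_num) (by norm_num)
    simpa only [mul_add, mul_one] using h2.add h1

/-- A continuous distance on a compact space induces the topology. -/
theorem tendsto_of_tendsto_continuous_dist {S : Type*} [TopologicalSpace S] [CompactSpace S]
    [T2Space S] {ρ : S → S → ℝ} (hρ : Continuous fun p : S × S => ρ p.1 p.2)
    (hρeq : ∀ s t, ρ s t = 0 → s = t) {x : ℕ → S} {s : S}
    (h : Tendsto (fun j => ρ s (x j)) atTop (nhds 0)) : Tendsto x atTop (nhds s) := by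
  refine isCompact_univ.tendsto_nhds_of_unique_mapClusterPt (Eventually.of_forall fun _ =>
    Set.mem_univ _) fun y _ hy => ?_
  have hc : Continuous fun y => ρ s y := hρ.comp (Continuous.prodMk_right s)
  have h1 : MapClusterPt (ρ s y) atTop (fun j => ρ s (x j)) := hy.continuousAt_comp hc.continuousAt
  exact (hρeq _ _ (eq_of_nhds_neBot (ClusterPt.mono h1 h))).symm

/-- Pathwise chaining bound for the sup norm. -/
theorem enorm_le_of_chain {S : Type*} [TopologicalSpace S] [CompactSpace S]
    {T : ℕ → Finset S} {p : ℕ → S → S} (hp : ∀ k s, p k s ∈ T k)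
    (hlim : ∀ s, Tendsto (fun k => p k s) atTop (nhds s)) (f : C(S, ℝ)) {K : ℕ} {a : ℝ}
    {q : ℕ → ℝ} (h0 : ∀ t ∈ T K, |f t| ≤ a)
    (hq : ∀ k, ∀ u ∈ T (K + k + 1), |f u - f (p (K + k) u)| ≤ q k) :
    ‖f‖ₑ ≤ ENNReal.ofReal a + ∑' k, ENNReal.ofReal (q k) := by
  have hJ : ∀ j, ∀ u ∈ T (K + j),
      ENNReal.ofReal |f u| ≤ ENNReal.ofReal a + ∑ k ∈ Finset.range j, ENNReal.ofReal (q k) := by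
    intro j
    induction j with
    | zero => intro u hu; simpa using ENNReal.ofReal_le_ofReal (h0 u hu)
    | succ j ih =>
      intro u hu
      rw [Finset.sum_range_succ, ← add_assoc]
      have h1 : |f u| ≤ |f (p (K + j) u)| + q j := by
        have := abs_add_le (f (p (K + j) u)) (f u - f (p (K + j) u))
        rw [add_sub_cancel] at this
        linarith [hq j u hu]
      exact (ENNReal.ofReal_le_ofReal h1).trans (ENNReal.ofReal_add_le.trans
        (add_le_add_left (ih _ (hp _ _)) _))
  have hs : ∀ s, ENNReal.ofReal |f s| ≤ ENNReal.ofReal a + ∑' k, ENNReal.ofReal (q k) := by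
    intro s
    have ht : Tendsto (fun j => ENNReal.ofReal |f (p (K + j) s)|) atTop
        (nhds (ENNReal.ofReal |f s|)) :=
      ENNReal.tendsto_ofReal (((f.continuous.tendsto s).comp ((hlim s).comp
        (tendsto_atTop_mono (fun j => Nat.le_add_left j K) tendsto_id))).abs)
    exact le_of_tendsto' ht fun j => (hJ j _ (hp _ _)).trans
      (add_le_add_right (ENNReal.sum_le_tsum _) _)
  rcases eq_or_ne (ENNReal.ofReal a + ∑' k, ENNReal.ofReal (q k)) ⊤ with h | h
  · simp [h]
  · rw [← ofReal_norm, ENNReal.ofReal_le_iff_le_toReal h]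
    refine (ContinuousMap.norm_le _ ENNReal.toReal_nonneg).2 fun s => ?_
    rw [Real.norm_eq_abs, ← ENNReal.ofReal_le_iff_le_toReal h]
    exact hs s

/-- A variable dominated by `ς r` is square integrable and its square is dominated by
`r²` times a conditional expectation of `ς²`. -/
theorem sq_le_mul_condExp_sq {Ω : Type*} {m m0 : MeasurableSpace Ω} {μ : Measure Ω}
    [IsFiniteMeasure μ] (hm : m ≤ m0) {Y ς : Ω → ℝ} (hYm : StronglyMeasurable[m] Y)
    (hς : Integrable (fun ω => ς ω ^ 2) μ) {r : ℝ} (hY : ∀ᵐ ω ∂μ, |Y ω| ≤ ς ω * r) :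
    MemLp Y 2 μ ∧ ∀ᵐ ω ∂μ, Y ω ^ 2 ≤ r ^ 2 * (μ[fun ω => ς ω ^ 2|m]) ω := by
  have hle : (fun ω => Y ω ^ 2) ≤ᵐ[μ] fun ω => r ^ 2 * ς ω ^ 2 := by
    filter_upwards [hY] with ω h
    have := pow_le_pow_left₀ (abs_nonneg _) h 2
    rw [sq_abs] at this
    linarith
  have hYi : Integrable (fun ω => Y ω ^ 2) μ := by
    refine (hς.const_mul (r ^ 2)).mono' ((hYm.mono hm).pow 2).aestronglyMeasurable ?_
    filter_upwards [hle] with ω h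
    rwa [Real.norm_eq_abs, abs_of_nonneg (sq_nonneg _)]
  refine ⟨(memLp_two_iff_integrable_sq (hYm.mono hm).aestronglyMeasurable).2 hYi, ?_⟩
  have h1 := condExp_mono (m := m) hYi (hς.const_mul (r ^ 2)) hle
  rw [condExp_of_stronglyMeasurable hm (f := fun ω => Y ω ^ 2) (hYm.pow 2) hYi] at h1
  filter_upwards [h1, condExp_smul (r ^ 2) (fun ω => ς ω ^ 2) m (μ := μ)] with ω a b
  exact a.trans (b.trans_le le_rfl)

/-- Chaining bound for the mean sup norm of a normalized sum of martingale differences in `C(S)`. -/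
theorem lintegral_enorm_sum_le {Ω : Type*} {m0 : MeasurableSpace Ω}
    {μ : Measure Ω} [IsProbabilityMeasure μ] (ℱ : Filtration ℕ m0)
    {S : Type*} [TopologicalSpace S] [CompactSpace S] [Nonempty S] {Z : ℕ → Ω → C(S, ℝ)}
    (hZm : ∀ i s, StronglyMeasurable[ℱ (i + 1)] fun ω => Z i ω s)
    (hmd : ∀ i s, μ[fun ω => Z i ω s|ℱ i] =ᵐ[μ] 0) {s0 : S} (hZ0 : ∀ i ω, Z i ω s0 = 0)
    {ρ : S → S → ℝ} {ς : ℕ → Ω → ℝ} (hς0 : ∀ i ω, 0 ≤ ς i ω)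
    (hς : ∀ i, Integrable (fun ω => ς i ω ^ 2) μ)
    (hZ : ∀ i s t, ∀ᵐ ω ∂μ, |Z i ω s - Z i ω t| ≤ ς i ω * ρ s t)
    {b : ℝ} (hb : ∀ i, ∀ᵐ ω ∂μ, (μ[fun ω' => ς i ω' ^ 2|ℱ i]) ω ≤ b)
    {T : ℕ → Finset S} {p : ℕ → S → S} {h : ℕ → ℝ} (hp : ∀ k s, p k s ∈ T k)
    (hρp : ∀ k s, ρ s (p k s) ≤ (1 / 2) ^ k) (hh : ∀ k, 0 < h k)
    (hcard : ∀ k, 1 + Real.log (T (k + 1)).card ≤ h k ^ 2)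
    (hlim : ∀ s, Tendsto (fun k => p k s) atTop (nhds s))
    {D : ℝ} (hD : ∀ s, ρ s s0 ≤ D) {ε : ℝ} (hε : 0 < ε) (K : ℕ) {n : ℕ} (hn : 0 < n) :
    ∫⁻ ω, ‖(Real.sqrt n)⁻¹ • ∑ i ∈ Finset.range n, Z i ω‖ₑ ∂μ ≤
      ENNReal.ofReal (ε + ε⁻¹ * ((T K).card *
        (D ^ 2 * ((n : ℝ)⁻¹ * ∑ i ∈ Finset.range n, ∫ ω, ς i ω ^ 2 ∂μ)))) +
      ∑' k, ENNReal.ofReal ((1 / 2) ^ (k + K) * h (k + K) *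
        (1 + b + 2 * ((n : ℝ)⁻¹ * ∑ i ∈ Finset.range n, ∫ ω, ς i ω ^ 2 ∂μ))) := by
  have hnp : (0 : ℝ) < n := by exact_mod_cast hn
  set W : ℕ → Ω → ℝ := fun i => μ[fun ω => ς i ω ^ 2|ℱ (i + 1)] with hW
  have hWint : ∀ i, ∫ ω, W i ω ∂μ = ∫ ω, ς i ω ^ 2 ∂μ := fun i => integral_condExp (ℱ.le _)
  have hWb : ∀ i, ∀ᵐ ω ∂μ, (μ[W i|ℱ i]) ω ≤ b := fun i => by
    filter_upwards [condExp_condExp_of_le (μ := μ) (f := fun ω => ς i ω ^ 2)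
      (ℱ.mono (Nat.le_succ i)) (ℱ.le (i + 1)), hb i] with ω h1 h2
    exact h1.trans_le h2
  have hlink : ∀ k, _ := fun k => exists_integrable_link_bound (μ := μ) ℱ (F := T (k + K + 1))
    ⟨_, hp _ s0⟩ (Y := fun u i ω => Z i ω u - Z i ω (p (k + K) u)) (W := W)
    (b := b) (r := (1 / 2) ^ (k + K)) (h := h (k + K)) (n := n)
    (fun u i => (hZm i u).sub (hZm i _))
    (fun u i => by
      have hi : ∀ s, Integrable (fun ω => Z i ω s) μ := fun s =>
        (sq_le_mul_condExp_sq (ℱ.le (i + 1)) (hZm i s) (hς i)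
          (by simpa [hZ0] using hZ i s s0)).1.integrable one_le_two
      filter_upwards [condExp_sub (hi u) (hi (p (k + K) u)) (ℱ i), hmd i u,
        hmd i (p (k + K) u)] with ω h1 h2 h3
      refine h1.trans ?_
      simp [h2, h3])
    (fun i => stronglyMeasurable_condExp) (fun i => integrable_condExp) hWb (by positivity)
    (hh _) (hcard _)
    (fun u i => (sq_le_mul_condExp_sq (ℱ.le (i + 1)) ((hZm i u).sub (hZm i _)) (hς i) (by
      filter_upwards [hZ i u (p (k + K) u)] with ω h1
      exact h1.trans (mul_le_mul_of_nonneg_left (hρp _ _) (hς0 _ _)))).2) hn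
  choose Q hQi hQ hQint using hlink
  have hZs : ∀ s i, MemLp (fun ω => Z i ω s) 2 μ ∧
      ∫ ω, Z i ω s ^ 2 ∂μ ≤ D ^ 2 * ∫ ω, ς i ω ^ 2 ∂μ := fun s i => by
    obtain ⟨h1, h2⟩ := sq_le_mul_condExp_sq (μ := μ) (r := D) (ℱ.le (i + 1)) (hZm i s) (hς i) (by
      filter_upwards [hZ i s s0] with ω h1
      rw [hZ0, sub_zero] at h1
      exact h1.trans (mul_le_mul_of_nonneg_left (hD _) (hς0 _ _)))
    refine ⟨h1, ?_⟩
    have := integral_mono_ae h1.integrable_sq (integrable_condExp.const_mul _) h2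
    rwa [integral_const_mul, integral_condExp (ℱ.le _)] at this
  set V : S → Ω → ℝ := fun s ω => (Real.sqrt n)⁻¹ * ∑ i ∈ Finset.range n, Z i ω s with hV
  have hVi : ∀ s, Integrable (fun ω => V s ω ^ 2) μ := fun s => by
    refine MemLp.integrable_sq (MemLp.const_mul ?_ _)
    exact memLp_finsetSum _ fun i _ => (hZs s i).1
  have hVint : ∀ s, ∫ ω, V s ω ^ 2 ∂μ ≤
      D ^ 2 * ((n : ℝ)⁻¹ * ∑ i ∈ Finset.range n, ∫ ω, ς i ω ^ 2 ∂μ) := fun s => by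
    simp only [hV, mul_pow, inv_pow, Real.sq_sqrt hnp.le]
    rw [integral_const_mul, integral_sq_sum_martingale_difference ℱ (fun i => hZm i s)
      (fun i => (hZs s i).1) (fun i => hmd i s), mul_left_comm (D ^ 2)]
    refine mul_le_mul_of_nonneg_left ?_ (by positivity)
    rw [Finset.mul_sum]
    exact Finset.sum_le_sum fun i _ => (hZs s i).2
  set a : Ω → ℝ := fun ω => ε + ε⁻¹ * ∑ s ∈ T K, V s ω ^ 2 with ha
  have hai : Integrable a μ :=
    (integrable_const _).add ((integrable_finsetSum _ fun s _ => hVi s).const_mul _)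
  have hQ0 : ∀ k, 0 ≤ᵐ[μ] Q k := fun k => by
    filter_upwards [hQ k] with ω h1
    exact (abs_nonneg _).trans (h1 _ (hp _ s0))
  calc _ ≤ ∫⁻ ω, (ENNReal.ofReal (a ω) + ∑' k, ENNReal.ofReal (Q k ω)) ∂μ := by
        refine lintegral_mono_ae ?_
        filter_upwards [ae_all_iff.2 hQ] with ω hω
        refine enorm_le_of_chain hp hlim _ (K := K) (fun t ht => ?_) fun k u hu => ?_
        · have e1 : |V t ω| ≤ ε + ε⁻¹ * V t ω ^ 2 := by
            rw [← sq_abs (V t ω)]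
            have := sq_nonneg (|V t ω| - ε)
            have h2 : |V t ω| * ε ≤ ε * ε + |V t ω| ^ 2 := by nlinarith [abs_nonneg (V t ω)]
            rw [← mul_le_mul_iff_left₀ hε]
            calc _ ≤ _ := h2
              _ = _ := by field_simp
          have e2 : V t ω ^ 2 ≤ ∑ s ∈ T K, V s ω ^ 2 :=
            Finset.single_le_sum (f := fun s => V s ω ^ 2) (fun s _ => sq_nonneg _) ht
          have e3 := mul_le_mul_of_nonneg_left e2 (inv_pos.2 hε).le
          simpa [hV] using e1.trans (by linarith : _ ≤ a ω)
        · rw [add_comm K k] at hu ⊢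
          have := hω k u hu
          simpa [mul_sub, Finset.sum_sub_distrib] using this
    _ = ENNReal.ofReal (∫ ω, a ω ∂μ) + ∑' k, ENNReal.ofReal (∫ ω, Q k ω ∂μ) := by
        rw [lintegral_add_left' hai.aemeasurable.ennreal_ofReal,
          lintegral_tsum fun k => (hQi k).aemeasurable.ennreal_ofReal,
          ofReal_integral_eq_lintegral_ofReal hai (Eventually.of_forall fun ω => by
            simp only [ha]; positivity)]
        congr 2
        ext k
        rw [ofReal_integral_eq_lintegral_ofReal (hQi k) (hQ0 k)]
    _ ≤ _ := by
        gcongr with k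
        · simp only [ha]
          rw [integral_add (integrable_const _)
            ((integrable_finsetSum _ fun s _ => hVi s).const_mul _), integral_const_mul,
            integral_finsetSum _ fun s _ => hVi s]
          simp only [integral_const, probReal_univ, one_smul]
          gcongr
          exact (Finset.sum_le_sum fun s _ => hVint s).trans_eq (by simp)
        · simpa only [hWint] using hQint k

/-- A normalized sum of martingale differences in `C(S)` that vanish at a point and have
asymptotically negligible Lipschitz constants tends to zero in mean sup norm. -/
theorem tendsto_lintegral_enorm_sum {Ω : Type*} {m0 : MeasurableSpace Ω}
    {μ : Measure Ω} [IsProbabilityMeasure μ] (ℱ : Filtration ℕ m0)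
    {S : Type*} [TopologicalSpace S] [CompactSpace S] [T2Space S] {Z : ℕ → Ω → C(S, ℝ)}
    (hZm : ∀ i s, StronglyMeasurable[ℱ (i + 1)] fun ω => Z i ω s)
    (hmd : ∀ i s, μ[fun ω => Z i ω s|ℱ i] =ᵐ[μ] 0) {s0 : S} (hZ0 : ∀ i ω, Z i ω s0 = 0)
    {ρ : S → S → ℝ} (hρ : Continuous fun p : S × S => ρ p.1 p.2) (hρ0 : ∀ s t, 0 ≤ ρ s t)
    (hρeq : ∀ s t, ρ s t = 0 ↔ s = t)
    (hent : IntegrableOn (fun r => Real.sqrt (metricEntropy ρ r)) (Set.Ioc (0 : ℝ) 1))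
    {ς : ℕ → Ω → ℝ} (hς0 : ∀ i ω, 0 ≤ ς i ω)
    (hς : ∀ i, Integrable (fun ω => ς i ω ^ 2) μ)
    (hςlim : Tendsto (fun n : ℕ =>
      (n : ℝ)⁻¹ * ∑ i ∈ Finset.range n, ∫ ω, ς i ω ^ 2 ∂μ) atTop (nhds 0))
    (hZ : ∀ i s t, ∀ᵐ ω ∂μ, |Z i ω s - Z i ω t| ≤ ς i ω * ρ s t)
    {b : ℝ} (hb : ∀ i, ∀ᵐ ω ∂μ, (μ[fun ω' => ς i ω' ^ 2|ℱ i]) ω ≤ b) :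
    Tendsto (fun n : ℕ => ∫⁻ ω, ‖(Real.sqrt n)⁻¹ • ∑ i ∈ Finset.range n, Z i ω‖ₑ ∂μ)
      atTop (nhds 0) := by
  have : Nonempty S := ⟨s0⟩
  obtain ⟨T, p, h, hp, hρp, hh, hcard, hsum⟩ :=
    exists_dyadic_nets hρ (fun s => (hρeq s s).2 rfl) hent
  have hlim : ∀ s, Tendsto (fun k => p k s) atTop (nhds s) := fun s =>
    tendsto_of_tendsto_continuous_dist hρ (fun s t => (hρeq s t).1)
      (squeeze_zero (fun _ => hρ0 _ _) (fun k => hρp k s)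
        (tendsto_pow_atTop_nhds_zero_of_lt_one (by norm_num) (by norm_num)))
  obtain ⟨D, hD⟩ : ∃ D, ∀ s, ρ s s0 ≤ D := by
    obtain ⟨D, hD⟩ := (isCompact_range (hρ.comp (Continuous.prodMk_left s0))).bddAbove
    exact ⟨D, fun s => hD ⟨s, rfl⟩⟩
  set δ : ℕ → ℝ := fun n => (n : ℝ)⁻¹ * ∑ i ∈ Finset.range n, ∫ ω, ς i ω ^ 2 ∂μ with hδ
  set G : ℕ → ENNReal := fun k => ENNReal.ofReal ((1 / 2) ^ k * h k * (1 + b + 2 * 1)) with hG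
  have hGsum : ∑' k, G k ≠ ⊤ := (hsum.mul_right _).tsum_ofReal_ne_top
  refine ENNReal.tendsto_nhds_zero.2 fun η hη => ?_
  have hη2 : 0 < η / 2 := ENNReal.half_pos hη.ne'
  obtain ⟨K, hK⟩ := ((ENNReal.tendsto_sum_nat_add G hGsum).eventually_le_const hη2).exists
  obtain ⟨ε, hε, hεη⟩ := ENNReal.lt_iff_exists_nnreal_btwn.1 hη2
  have hε : (0 : ℝ) < ε := by exact_mod_cast hε
  have hcoarse : Tendsto (fun n => ENNReal.ofReal (ε + (ε : ℝ)⁻¹ * ((T K).card * (D ^ 2 * δ n))))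
      atTop (nhds ε) := by
    have h1 := ENNReal.tendsto_ofReal
      ((((hςlim.const_mul (D ^ 2)).const_mul ((T K).card : ℝ)).const_mul (ε : ℝ)⁻¹).const_add
        (ε : ℝ))
    simpa using h1
  filter_upwards [hcoarse.eventually_le_const hεη, hςlim.eventually_le_const one_pos,
    eventually_gt_atTop 0] with n h1 h2 hn
  refine (lintegral_enorm_sum_le ℱ hZm hmd hZ0 hς0 hς hZ hb hp hρp hh hcard hlim hD hε K hn).trans
    ?_
  rw [← ENNReal.add_halves η]
  refine add_le_add h1 (le_trans (ENNReal.tsum_le_tsum fun k => ENNReal.ofReal_le_ofReal ?_) hK)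
  have := hh (k + K)
  gcongr

/-- The law of a Gaussian multiple of a fixed vector is a Gaussian measure. -/
theorem isGaussianMeasure_map_smul {B : Type*} [NormedAddCommGroup B] [NormedSpace ℝ B]
    [MeasurableSpace B] [BorelSpace B] (v : B) (c : NNReal) :
    IsGaussianMeasure ((ProbabilityTheory.gaussianReal 0 c).map fun x : ℝ => x • v) := by
  intro L
  have hv : Continuous fun x : ℝ => x • v := by fun_prop
  rw [Measure.map_map L.continuous.measurable hv.measurable]
  have e : (L ∘ fun x : ℝ => x • v) = fun x => L v * x := by
    ext x
    simp [mul_comm]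
  rw [e, ProbabilityTheory.gaussianReal_map_const_mul]
  exact ⟨_, _, rfl⟩

/-- Functional CLT for martingale difference sequences in `C(S)` under (A4), (A5),
(A6') and (A7). -/
theorem stmt15
    {Ω : Type*} {m0 : MeasurableSpace Ω} {μ : Measure Ω} [IsProbabilityMeasure μ]
    {S : Type*} [MetricSpace S] [CompactSpace S] [Nonempty S]
    [MeasurableSpace C(S, ℝ)] [BorelSpace C(S, ℝ)]
    (ℱ : Filtration ℕ m0) (X : ℕ → Ω → C(S, ℝ))
    (hXmeas : ∀ i, Measurable (X i))
    (hadapt : ∀ i, Measurable[ℱ (i + 1)] (X i))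
    (hint : ∀ i s, Integrable (fun ω => X i ω s) μ)
    -- martingale difference sequence
    (hmd : ∀ i s, μ[fun ω => X i ω s | ℱ i] =ᵐ[μ] 0)
    -- (A4)
    (s0 : S) (k : ℝ) (hkpos : 0 < k)
    (hA4 : ∀ i, ∀ᵐ ω ∂μ, |X i ω s0| ≤ k)
    -- (A5)
    (c : ℝ) (hc : 0 < c)
    (hA5 : TendstoInMeasure μ
      (fun (n : ℕ) ω => (n : ℝ)⁻¹ * ∑ i ∈ Finset.range n,
        (μ[fun ω' => (X i ω' s0) ^ 2 | ℱ i]) ω) atTop (fun _ => c))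
    -- a continuous distance `ρ` with finite metric-entropy integral
    (ρ : S → S → ℝ) (hρcont : Continuous fun p : S × S => ρ p.1 p.2)
    (hρnn : ∀ s1 s2, 0 ≤ ρ s1 s2) (hρsymm : ∀ s1 s2, ρ s1 s2 = ρ s2 s1)
    (hρeq : ∀ s1 s2, ρ s1 s2 = 0 ↔ s1 = s2)
    (hρtri : ∀ s1 s2 s3, ρ s1 s3 ≤ ρ s1 s2 + ρ s2 s3)
    (hent : IntegrableOn (fun r => Real.sqrt (metricEntropy ρ r)) (Set.Ioc (0 : ℝ) 1))
    -- (A6')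
    (ς : ℕ → Ω → ℝ) (hςnn : ∀ i ω, 0 ≤ ς i ω)
    (hςint : ∀ i, Integrable (fun ω => (ς i ω) ^ 2) μ)
    (hA6'lim : Tendsto (fun n : ℕ =>
        (n : ℝ)⁻¹ * ∑ i ∈ Finset.range n, ∫ ω, (ς i ω) ^ 2 ∂μ) atTop (nhds 0))
    (hA6' : ∀ i s1 s2, ∀ᵐ ω ∂μ, |X i ω s1 - X i ω s2| ≤ ς i ω * ρ s1 s2)
    -- (A7)
    (bbar : ℝ) (hbbar : 0 < bbar)
    (hA7 : ∀ i, ∀ᵐ ω ∂μ, (μ[fun ω' => (ς i ω') ^ 2 | ℱ i]) ω ≤ bbar) :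
    ∃ γ : Measure C(S, ℝ), IsProbabilityMeasure γ ∧ IsGaussianMeasure γ ∧
      ∀ f : BoundedContinuousFunction C(S, ℝ) ℝ,
        Tendsto (fun n : ℕ =>
            ∫ ω, f ((Real.sqrt n)⁻¹ • ∑ i ∈ Finset.range n, X i ω) ∂μ)
          atTop (nhds (∫ g, f g ∂γ)) := by
  lift c to NNReal using hc.le
  have hXm : ∀ i s, StronglyMeasurable[ℱ (i + 1)] fun ω => X i ω s := fun i s =>
    ((continuous_eval_const s).measurable.comp (hadapt i)).stronglyMeasurable
  set Z : ℕ → Ω → C(S, ℝ) := fun i ω => X i ω - X i ω s0 • (1 : C(S, ℝ)) with hZ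
  have hZs : ∀ i ω s, Z i ω s = X i ω s - X i ω s0 := fun i ω s => by simp [hZ]
  have hlim := tendsto_lintegral_enorm_sum ℱ (Z := Z) (s0 := s0) (b := bbar)
    (fun i s => by
      simp only [hZs]
      exact (hXm i s).sub (hXm i s0))
    (fun i s => by
      simp only [hZs]
      filter_upwards [condExp_sub (hint i s) (hint i s0) (ℱ i), hmd i s, hmd i s0]
        with ω h1 h2 h3
      refine h1.trans ?_
      simp [h2, h3])
    (fun i ω => by simp [hZs]) hρcont hρnn hρeq hent hςnn hςint hA6'lim
    (fun i s t => by simpa only [hZs, sub_sub_sub_cancel_right] using hA6' i s t) hA7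
  have hclt := (tendstoInDistribution_of_bounded_martingale_difference ℱ
    (fun i => hXm i s0) hA4 (fun i => hmd i s0) hA5).continuous_comp
    (g := fun x : ℝ => x • (1 : C(S, ℝ))) (by fun_prop)
  set V : ℕ → Ω → C(S, ℝ) := fun n ω => (Real.sqrt n)⁻¹ • ∑ i ∈ Finset.range n, X i ω with hV
  have hVm : ∀ n, AEMeasurable (V n) μ := fun n =>
    ((Finset.measurable_fun_sum (Finset.range n) fun i _ => hXmeas i).const_smul
      (Real.sqrt n)⁻¹).aemeasurable
  have hconv := tendstoInDistribution_of_tendstoInMeasure_sub V _ hclt (by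
    refine tendstoInMeasure_of_tendsto_eLpNorm one_ne_zero (fun n => ?_)
      aestronglyMeasurable_const ?_
    · exact ((hVm n).sub (hclt.forall_aemeasurable n)).aestronglyMeasurable
    · refine hlim.congr fun n => ?_
      rw [eLpNorm_one_eq_lintegral_enorm]
      refine lintegral_congr fun ω => ?_
      congr 1
      simp [hV, hZ, Finset.sum_sub_distrib, smul_sub, Finset.sum_smul, mul_smul]) hVm
  refine ⟨_, Measure.isProbabilityMeasure_map hconv.aemeasurable_limit,
    isGaussianMeasure_map_smul 1 _, fun f => ?_⟩
  have h := ProbabilityMeasure.tendsto_iff_forall_integral_tendsto.1 hconv.tendsto f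
  simp only [ProbabilityMeasure.coe_mk] at h
  refine h.congr fun n => ?_
  rw [integral_map (hVm n) f.continuous.aestronglyMeasurable]
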